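/- arXiv:1410.8438 — 3 statements merged into one kernel-verified Lean document; each statement's English description precedes it below -/
import Mathlib

section
/- Let H be a divisible lattice-ordered abelian group and let G be a sublattice-subgroup of H such that for every h ∈ H there exists an integer n ≥ 1 with n • h ∈ G. Let K be a divisible lattice-ordered abelian group and f : G → K a lattice-group homomorphism. Then there exists a unique lattice-group homomorphism f̄ : H → K extending f, and if f is injective then f̄ is injective. (Universal property of the divisible hull.) -/
section LatticeOrderedGroup

variable {A : Type*} [Lattice A] [AddCommGroup A] [IsOrderedAddMonoid A]

theorem succ_nsmul_inf_zero (x : A) (n : ℕ) :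
    (n + 1) • (x ⊓ 0) = n • (x ⊓ 0) ⊓ (n + 1) • x := by
  induction n with
  | zero => simp [inf_comm]
  | succ n ih =>
    have hle : (n + 1) • (x ⊓ 0) ≤ n • (x ⊓ 0) + x := by
      rw [succ_nsmul]
      gcongr
      exact inf_le_left
    have hadd : (n + 1) • (x ⊓ 0) + x = (n • (x ⊓ 0) + x) ⊓ (n + 1 + 1) • x := by
      rw [ih, inf_add, ← succ_nsmul]
    calc (n + 1 + 1) • (x ⊓ 0)
        = ((n + 1) • (x ⊓ 0) + x) ⊓ (n + 1) • (x ⊓ 0) := by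
          rw [succ_nsmul _ (n + 1), add_inf, add_zero]
      _ = (n + 1) • (x ⊓ 0) ⊓ (n + 1 + 1) • x := by
          rw [hadd, inf_right_comm, inf_eq_right.2 hle]

theorem nonneg_of_zsmul_nonneg {x : A} {n : ℤ} (hn : 1 ≤ n) (h : 0 ≤ n • x) : 0 ≤ x := by
  obtain ⟨k, rfl⟩ : ∃ k : ℕ, n = ((k + 1 : ℕ) : ℤ) := ⟨(n - 1).toNat, by omega⟩
  rw [natCast_zsmul] at h
  have hle : k • (x ⊓ 0) ≤ (k + 1) • x := (nsmul_nonpos inf_le_right k).trans h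
  have key := succ_nsmul_inf_zero x k
  rw [inf_eq_left.2 hle, succ_nsmul, add_eq_left] at key
  exact inf_eq_right.1 key

theorem le_of_zsmul_le_zsmul {x y : A} {n : ℤ} (hn : 1 ≤ n) (h : n • x ≤ n • y) : x ≤ y := by
  rw [← sub_nonneg, ← zsmul_sub] at h
  exact sub_nonneg.1 (nonneg_of_zsmul_nonneg hn h)

theorem eq_of_zsmul_eq_zsmul {x y : A} {n : ℤ} (hn : 1 ≤ n) (h : n • x = n • y) : x = y :=
  le_antisymm (le_of_zsmul_le_zsmul hn h.le) (le_of_zsmul_le_zsmul hn h.ge)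

theorem zsmul_sup_of_divisible (hdiv : ∀ (g : A) (n : ℤ), 1 ≤ n → ∃ x : A, n • x = g)
    {n : ℤ} (hn : 1 ≤ n) (a b : A) : n • (a ⊔ b) = n • a ⊔ n • b := by
  have hn0 : 0 ≤ n := by omega
  apply le_antisymm
  · obtain ⟨d, hd⟩ := hdiv (n • a ⊔ n • b) n hn
    rw [← hd]
    refine zsmul_le_zsmul_right hn0 (sup_le ?_ ?_)
    · exact le_of_zsmul_le_zsmul hn (hd ▸ le_sup_left)
    · exact le_of_zsmul_le_zsmul hn (hd ▸ le_sup_right)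
  · exact sup_le (zsmul_le_zsmul_right hn0 le_sup_left) (zsmul_le_zsmul_right hn0 le_sup_right)

end LatticeOrderedGroup


/-- Universal property of the divisible hull: if `G` is a sublattice-subgroup of a
divisible lattice-ordered abelian group `H` such that every element of `H` has a
positive multiple in `G`, then every lattice-group homomorphism `f` from `G` to a
divisible lattice-ordered abelian group `K` extends uniquely to a lattice-group
homomorphism `H → K`, which is injective whenever `f` is. -/
theorem divisible_hull_universal_property
    (H : Type) [Lattice H] [AddCommGroup H]
    (hHcov : ∀ a b c : H, a ≤ b → a + c ≤ b + c)
    (hHdiv : ∀ (g : H) (n : ℤ), 1 ≤ n → ∃ x : H, n • x = g)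
    (G : AddSubgroup H)
    (hGsup : ∀ a ∈ G, ∀ b ∈ G, a ⊔ b ∈ G)
    (hGinf : ∀ a ∈ G, ∀ b ∈ G, a ⊓ b ∈ G)
    (hGfull : ∀ h : H, ∃ n : ℤ, 1 ≤ n ∧ n • h ∈ G)
    (K : Type) [Lattice K] [AddCommGroup K]
    (hKcov : ∀ a b c : K, a ≤ b → a + c ≤ b + c)
    (hKdiv : ∀ (g : K) (n : ℤ), 1 ≤ n → ∃ x : K, n • x = g)
    (f : G → K)
    (hf_add : ∀ a b : G, f (a + b) = f a + f b)
    (hf_sup : ∀ a b : G, f ⟨(a : H) ⊔ (b : H), hGsup a a.2 b b.2⟩ = f a ⊔ f b) :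
    ∃ fbar : H → K,
      (∀ a b : H, fbar (a + b) = fbar a + fbar b) ∧
      (∀ a b : H, fbar (a ⊔ b) = fbar a ⊔ fbar b) ∧
      (∀ a : G, fbar (a : H) = f a) ∧
      (Function.Injective f → Function.Injective fbar) ∧
      (∀ g : H → K, (∀ a b : H, g (a + b) = g a + g b) →
        (∀ a b : H, g (a ⊔ b) = g a ⊔ g b) →
        (∀ a : G, g (a : H) = f a) → g = fbar) := by
  have : IsOrderedAddMonoid H := { add_le_add_left := fun a b h c => hHcov a b c h }
  have : IsOrderedAddMonoid K := { add_le_add_left := fun a b h c => hKcov a b c h }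
  let F : G →+ K := AddMonoidHom.mk' f hf_add
  choose N hN hNG using hGfull
  choose fbar hfbar using fun h : H => hKdiv (f ⟨N h • h, hNG h⟩) (N h) (hN h)
  have zsmul_fbar (h : H) (m : ℤ) (hm : m • h ∈ G) : m • fbar h = f ⟨m • h, hm⟩ := by
    apply eq_of_zsmul_eq_zsmul (hN h)
    rw [smul_comm, hfbar]
    change m • F _ = N h • F _
    rw [← map_zsmul, ← map_zsmul]
    congr 1
    exact Subtype.ext (smul_comm _ _ _)
  have common (a b : H) : ∃ m : ℤ, 1 ≤ m ∧ m • a ∈ G ∧ m • b ∈ G := by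
    refine ⟨N a * N b, one_le_mul_of_one_le_of_one_le (hN a) (hN b), ?_, ?_⟩
    · rw [mul_comm, mul_smul]
      exact G.zsmul_mem (hNG a) _
    · rw [mul_smul]
      exact G.zsmul_mem (hNG b) _
  refine ⟨fbar, fun a b => ?_, fun a b => ?_, fun a => ?_, fun hf a b hab => ?_,
    fun g hg_add _ hg => funext fun h => ?_⟩
  · obtain ⟨m, hm, ha, hb⟩ := common a b
    have hab : m • (a + b) ∈ G := smul_add m a b ▸ G.add_mem ha hb
    apply eq_of_zsmul_eq_zsmul hm
    rw [smul_add, zsmul_fbar _ m ha, zsmul_fbar _ m hb, zsmul_fbar _ m hab, ← hf_add]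
    exact congrArg f (Subtype.ext (smul_add m a b))
  · obtain ⟨m, hm, ha, hb⟩ := common a b
    have hsup := zsmul_sup_of_divisible hHdiv hm a b
    have hab : m • (a ⊔ b) ∈ G := hsup ▸ hGsup _ ha _ hb
    apply eq_of_zsmul_eq_zsmul hm
    rw [zsmul_sup_of_divisible hKdiv hm, zsmul_fbar _ m ha, zsmul_fbar _ m hb,
      zsmul_fbar _ m hab, ← hf_sup]
    exact congrArg f (Subtype.ext hsup)
  · simpa using zsmul_fbar a 1 (by simp)
  · obtain ⟨m, hm, ha, hb⟩ := common a b
    apply eq_of_zsmul_eq_zsmul hm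
    refine congrArg Subtype.val (hf (a₁ := ⟨m • a, ha⟩) (a₂ := ⟨m • b, hb⟩) ?_)
    rw [← zsmul_fbar, ← zsmul_fbar, hab]
  · apply eq_of_zsmul_eq_zsmul (hN h)
    rw [hfbar, ← hg]
    exact (map_zsmul (AddMonoidHom.mk' g hg_add) (N h) h).symm
end

section
/- Let H be a lattice-ordered abelian group and let G be a sublattice-subgroup of H such that for every h ∈ H there exists an integer n ≥ 1 with n • h ∈ G. If G is archimedean then H is archimedean. (The divisible hull of a semisimple MV-algebra is semisimple, in lattice-group form.) -/
/-- In a lattice-ordered abelian group, an element with a nonpositive positive multiple is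
nonpositive. -/
theorem nonpos_of_nsmul_nonpos {H : Type*} [Lattice H] [AddCommGroup H] [IsOrderedAddMonoid H]
    {p : ℕ} (hp : 0 < p) {x : H} (h : p • x ≤ 0) : x ≤ 0 := by
  have hne : (Finset.range p).Nonempty := ⟨0, Finset.mem_range.2 hp⟩
  set b := (Finset.range p).sup' hne (fun i => i • x) with hb
  have hle : ∀ i, i < p → i • x ≤ b := fun i hi =>
    Finset.le_sup' (fun i => i • x) (Finset.mem_range.2 hi)
  have hbx : b ≤ b - x := by
    refine Finset.sup'_le hne _ fun i hi => ?_
    rw [le_sub_iff_add_le, ← succ_nsmul]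
    rcases (Nat.succ_le_of_lt (Finset.mem_range.1 hi)).lt_or_eq with hlt | heq
    · exact hle _ hlt
    · rw [Nat.succ_eq_add_one] at heq
      rw [heq]
      exact h.trans (by simpa using hle 0 hp)
  simpa using hbx

/-- If `G` is a sublattice-subgroup of a lattice-ordered abelian group `H` such that
every element of `H` has a positive integer multiple in `G`, and `G` is archimedean,
then `H` is archimedean. -/
theorem divisible_hull_archimedean
    (H : Type) [Lattice H] [AddCommGroup H]
    (hHcov : ∀ a b c : H, a ≤ b → a + c ≤ b + c)
    (G : AddSubgroup H)
    (hGsup : ∀ a ∈ G, ∀ b ∈ G, a ⊔ b ∈ G)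
    (hGinf : ∀ a ∈ G, ∀ b ∈ G, a ⊓ b ∈ G)
    (hGfull : ∀ h : H, ∃ n : ℤ, 1 ≤ n ∧ n • h ∈ G)
    (hGarch : ∀ x y : H, x ∈ G → y ∈ G → (∀ n : ℕ, n • x ≤ y) → x ≤ 0) :
    ∀ x y : H, (∀ n : ℕ, n • x ≤ y) → x ≤ 0 := by
  have : IsOrderedAddMonoid H := { add_le_add_left := fun a b hab c => hHcov a b c hab }
  have hnat : ∀ h : H, ∃ n : ℕ, 1 ≤ n ∧ n • h ∈ G := fun h => by
    obtain ⟨n, hn, hmem⟩ := hGfull h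
    lift n to ℕ using by lia
    exact ⟨n, by exact_mod_cast hn, by simpa using hmem⟩
  intro x y hxy
  obtain ⟨p, hp, hpx⟩ := hnat x
  obtain ⟨q, hq, hqy⟩ := hnat y
  have hy : 0 ≤ y := by simpa using hxy 0
  refine nonpos_of_nsmul_nonpos hp (hGarch _ _ hpx hqy fun n => ?_)
  calc n • p • x = (n * p) • x := (mul_nsmul' x n p).symm
    _ ≤ y := hxy _
    _ = 1 • y := (one_nsmul y).symm
    _ ≤ q • y := nsmul_le_nsmul_left hy hq
end

section
/- Let G and H be lattice-ordered abelian groups and ι : G → H an injective lattice-group homomorphism. Then ι is essential (for every b ∈ H with b > 0 there exist a ∈ G with a > 0 and n ∈ ℕ with ι(a) ≤ n • b) if and only if for every solid subgroup I of H with I ≠ {0} one has I ∩ ι(G) ≠ {0}. -/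
/-- The elements of a lattice-ordered abelian group whose absolute value is bounded by a multiple
of a fixed element `b`; for `0 ≤ b` this is the solid subgroup generated by `b`. -/
def AddSubgroup.principalSolid {H : Type*} [Lattice H] [AddCommGroup H] [IsOrderedAddMonoid H]
    (b : H) : AddSubgroup H where
  carrier := {x | ∃ n : ℕ, |x| ≤ n • b}
  zero_mem' := ⟨0, by simp⟩
  add_mem' := by
    rintro x y ⟨m, hm⟩ ⟨n, hn⟩
    exact ⟨m + n, (abs_add_le x y).trans (by rw [add_nsmul]; exact add_le_add hm hn)⟩
  neg_mem' := by
    rintro x ⟨n, hn⟩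
    exact ⟨n, by rwa [abs_neg]⟩

theorem abs_pos_of_ne_zero {H : Type*} [Lattice H] [AddCommGroup H] [IsOrderedAddMonoid H]
    {x : H} (hx : x ≠ 0) : 0 < |x| := by
  refine (abs_nonneg x).lt_of_ne fun h => hx (le_antisymm ?_ ?_)
  · exact (le_abs_self x).trans h.ge
  · exact neg_nonpos.mp ((neg_le_abs x).trans h.ge)


/-- An injective lattice-group homomorphism `ι : G → H` is essential if and only if
every nonzero solid subgroup of `H` meets `ι(G)` nontrivially. -/
theorem essential_iff_meets_solid_subgroups
    (G : Type) [Lattice G] [AddCommGroup G]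
    (hGcov : ∀ a b c : G, a ≤ b → a + c ≤ b + c)
    (H : Type) [Lattice H] [AddCommGroup H]
    (hHcov : ∀ a b c : H, a ≤ b → a + c ≤ b + c)
    (ι : G → H) (hι_inj : Function.Injective ι)
    (hι_add : ∀ a b : G, ι (a + b) = ι a + ι b)
    (hι_sup : ∀ a b : G, ι (a ⊔ b) = ι a ⊔ ι b) :
    (∀ b : H, 0 < b → ∃ a : G, 0 < a ∧ ∃ n : ℕ, ι a ≤ n • b) ↔
    (∀ I : AddSubgroup H,
      (∀ x y : H, y ∈ I → x ⊔ -x ≤ y ⊔ -y → x ∈ I) →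
      (I : Set H) ≠ {0} → (I : Set H) ∩ Set.range ι ≠ {0}) := by
  have : IsOrderedAddMonoid G := { add_le_add_left := fun a b h c => hGcov a b c h }
  have : IsOrderedAddMonoid H := { add_le_add_left := fun a b h c => hHcov a b c h }
  let f : G →+ H := AddMonoidHom.mk' ι hι_add
  have hι_zero : ι 0 = 0 := map_zero f
  have hι_abs (a : G) : ι |a| = |ι a| := (hι_sup a (-a)).trans (congrArg (ι a ⊔ ·) (map_neg f a))
  constructor
  · intro hess I hI hne h
    obtain ⟨y, hyI, hy⟩ : ∃ y ∈ I, y ≠ 0 :=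
      I.bot_or_exists_ne_zero.resolve_left fun hbot => hne (by simp [hbot])
    obtain ⟨a, ha, n, hn⟩ := hess |y| (abs_pos_of_ne_zero hy)
    have habs : |y| ∈ I := hI _ y hyI (abs_abs y).le
    have haI : ι a ∈ I := by
      refine hI _ _ (I.nsmul_mem habs n) ?_
      change |ι a| ≤ |n • (|y|)|
      rw [← hι_abs, abs_of_nonneg ha.le]
      exact hn.trans (le_abs_self _)
    have hmem : ι a ∈ (I : Set H) ∩ Set.range ι := ⟨haI, a, rfl⟩
    rw [h, Set.mem_singleton_iff, ← hι_zero] at hmem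
    exact ha.ne' (hι_inj hmem)
  · intro hmeet b hb
    by_contra! hess
    refine hmeet (AddSubgroup.principalSolid b)
      (fun x y ⟨n, hn⟩ hxy => ⟨n, le_trans hxy hn⟩) (fun h => ?_) ?_
    · have hmem : b ∈ (AddSubgroup.principalSolid b : Set H) :=
        ⟨1, by rw [one_nsmul, abs_of_nonneg hb.le]⟩
      rw [h] at hmem
      exact hb.ne' hmem
    · refine Set.eq_singleton_iff_unique_mem.mpr ⟨⟨zero_mem _, 0, hι_zero⟩, ?_⟩
      rintro _ ⟨⟨n, hn⟩, g, rfl⟩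
      by_contra hg
      have hg0 : g ≠ 0 := fun h => hg (h ▸ hι_zero)
      exact hess |g| (abs_pos_of_ne_zero hg0) n ((hι_abs g).le.trans hn)
end
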